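/- arXiv:2501.03400 — 3 statements merged into one kernel-verified Lean document; each statement's English description precedes it below -/
import Mathlib

section
/- Let n, m ∈ ℕ, let Y_f ∈ ℂ^{m×n}, let v ∈ ℂⁿ, let l ∈ {1,…,m} and l_f ∈ {1,…,n}, let d_l ∈ ℂᵐ and e_{l_f} ∈ ℂⁿ be canonical basis vectors, and let Y_{l,p_f} = ½(Y_f* d_l e_{l_f}ᵀ + e_{l_f} d_lᵀ Y_f). Then Tr(Y_{l,p_f} v v*) = Re(v_{l_f} · conj((Y_f v)_l)), i.e., the trace form equals the active power flow p_{f,l} at the from end of branch l. -/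
open Matrix

/-- For canonical basis vectors `d_l ∈ ℂᵐ`, `e_{l_f} ∈ ℂⁿ`,
`Y_{l,p_f} = ½(Y_f* d_l e_{l_f}ᵀ + e_{l_f} d_lᵀ Y_f)` and the rank-one matrix `v v*`,
`Tr(Y_{l,p_f} v v*) = Re(v_{l_f} ⋅ conj((Y_f v)_l)) = p_{f,l}`. -/
theorem trace_Ylpf_vvstar {n m : ℕ} (Yf : Matrix (Fin m) (Fin n) ℂ) (v : Fin n → ℂ)
    (l : Fin m) (lf : Fin n) :
    Matrix.trace
        (((1 / 2 : ℂ) •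
            (Yfᴴ * Matrix.vecMulVec (Pi.single l (1 : ℂ)) (Pi.single lf (1 : ℂ)) +
              Matrix.vecMulVec (Pi.single lf (1 : ℂ)) (Pi.single l (1 : ℂ)) * Yf)) *
          Matrix.vecMulVec v (star v)) =
      (((v lf * (starRingEnd ℂ) ((Yf.mulVec v) l)).re : ℝ) : ℂ) := by
  have hconj : (Yfᴴ *ᵥ Pi.single l 1) ⬝ᵥ star v = (starRingEnd ℂ) ((Yf *ᵥ v) l) := by
    simp [Matrix.mulVec, dotProduct, Pi.single_apply]
  have hrow : (Pi.single l 1 ᵥ* Yf) ⬝ᵥ v = (Yf *ᵥ v) l := by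
    rw [← Matrix.dotProduct_mulVec, single_one_dotProduct]
  rw [Complex.re_eq_add_conj, Matrix.smul_mul, Matrix.trace_smul, Matrix.add_mul,
    Matrix.trace_add, Matrix.mul_vecMulVec, Matrix.vecMulVec_mul,
    Matrix.mul_vecMulVec, Matrix.mul_vecMulVec, Matrix.trace_vecMulVec, Matrix.trace_vecMulVec,
    Matrix.vecMulVec_mulVec, Matrix.vecMulVec_mulVec, hrow, single_one_dotProduct]
  simp only [op_smul_eq_smul, smul_dotProduct, hconj, single_one_dotProduct, smul_eq_mul,
    Pi.star_apply, map_mul, starRingEnd_apply, star_star]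
  ring
end

section
/- Let n, m ∈ ℕ, let Y_f ∈ ℂ^{m×n}, let v ∈ ℂⁿ, let l ∈ {1,…,m} and l_f ∈ {1,…,n}, let d_l ∈ ℂᵐ and e_{l_f} ∈ ℂⁿ be canonical basis vectors, and let Y_{l,q_f} = (i/2)(e_{l_f} d_lᵀ Y_f − Y_f* d_l e_{l_f}ᵀ). Then Tr(Y_{l,q_f} v v*) = Im(v_{l_f} · conj((Y_f v)_l)), i.e., the trace form equals the reactive power flow q_{f,l} at the from end of branch l. -/
open Matrix

/-- For canonical basis vectors `d_l ∈ ℂᵐ`, `e_{l_f} ∈ ℂⁿ`,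
`Y_{l,q_f} = (i/2)(e_{l_f} d_lᵀ Y_f − Y_f* d_l e_{l_f}ᵀ)` and the rank-one matrix `v v*`,
`Tr(Y_{l,q_f} v v*) = Im(v_{l_f} ⋅ conj((Y_f v)_l)) = q_{f,l}`. -/
theorem trace_Ylqf_vvstar {n m : ℕ} (Yf : Matrix (Fin m) (Fin n) ℂ) (v : Fin n → ℂ)
    (l : Fin m) (lf : Fin n) :
    Matrix.trace
        (((Complex.I / 2) •
            (Matrix.vecMulVec (Pi.single lf (1 : ℂ)) (Pi.single l (1 : ℂ)) * Yf -
              Yfᴴ * Matrix.vecMulVec (Pi.single l (1 : ℂ)) (Pi.single lf (1 : ℂ)))) *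
          Matrix.vecMulVec v (star v)) =
      (((v lf * (starRingEnd ℂ) ((Yf.mulVec v) l)).im : ℝ) : ℂ) := by
  have from_term : (vecMulVec (Pi.single lf (1 : ℂ)) (Pi.single l (1 : ℂ)) * Yf *
      vecMulVec v (star v)).trace = star (v lf) * (Yf *ᵥ v) l := by
    rw [Matrix.mul_assoc, mul_vecMulVec, mul_vecMulVec, trace_vecMulVec, vecMulVec_mulVec]
    simp [mul_comm]
  have to_term : (Yfᴴ * vecMulVec (Pi.single l (1 : ℂ)) (Pi.single lf (1 : ℂ)) *
      vecMulVec v (star v)).trace = v lf * star ((Yf *ᵥ v) l) := by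
    rw [Matrix.mul_assoc, mul_vecMulVec, vecMulVec_mulVec, mul_vecMulVec, trace_vecMulVec,
      dotProduct_comm, dotProduct_mulVec, ← star_mulVec]
    simp [mul_comm]
  rw [smul_mul, trace_smul, sub_mul, trace_sub, from_term, to_term]
  apply Complex.ext
  · simp
    ring
  · simp
end

section
/- Let n, m ∈ ℕ, let Y_t ∈ ℂ^{m×n}, let v ∈ ℂⁿ, let l ∈ {1,…,m} and l_t ∈ {1,…,n}, let d_l ∈ ℂᵐ and e_{l_t} ∈ ℂⁿ be canonical basis vectors, and let Y_{l,q_t} = (i/2)(e_{l_t} d_lᵀ Y_t − Y_t* d_l e_{l_t}ᵀ). Then Tr(Y_{l,q_t} v v*) = Im(v_{l_t} · conj((Y_t v)_l)), i.e., the trace form equals the reactive power flow q_{t,l} at the to end of branch l. -/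
open Matrix

/-- For canonical basis vectors `d_l ∈ ℂᵐ`, `e_{l_t} ∈ ℂⁿ`,
`Y_{l,q_t} = (i/2)(e_{l_t} d_lᵀ Y_t − Y_t* d_l e_{l_t}ᵀ)` and the rank-one matrix `v v*`,
`Tr(Y_{l,q_t} v v*) = Im(v_{l_t} ⋅ conj((Y_t v)_l)) = q_{t,l}`. -/
theorem trace_Ylqt_vvstar {n m : ℕ} (Yt : Matrix (Fin m) (Fin n) ℂ) (v : Fin n → ℂ)
    (l : Fin m) (lt : Fin n) :
    Matrix.trace
        (((Complex.I / 2) •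
            (Matrix.vecMulVec (Pi.single lt (1 : ℂ)) (Pi.single l (1 : ℂ)) * Yt -
              Ytᴴ * Matrix.vecMulVec (Pi.single l (1 : ℂ)) (Pi.single lt (1 : ℂ)))) *
          Matrix.vecMulVec v (star v)) =
      (((v lt * (starRingEnd ℂ) ((Yt.mulVec v) l)).im : ℝ) : ℂ) := by
  have h : (Ytᴴ *ᵥ Pi.single l 1) ⬝ᵥ star v = star ((Yt *ᵥ v) l) := by
    rw [mulVec_single_one]
    simp [dotProduct, mulVec]
  rw [mul_vecMulVec, trace_vecMulVec, smul_mulVec, sub_mulVec, ← mulVec_mulVec,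
    ← mulVec_mulVec, vecMulVec_mulVec, vecMulVec_mulVec, mulVec_smul, smul_dotProduct,
    sub_dotProduct, smul_dotProduct, smul_dotProduct, h]
  simp only [single_one_dotProduct, Pi.star_apply, op_smul_eq_smul, smul_eq_mul]
  apply Complex.ext <;> simp <;> ring
end
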